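/- arXiv:2105.04040 — 3 statements merged into one kernel-verified Lean document; each statement's English description precedes it below -/
import Mathlib

section
/- APS downsampling is σ-equivariant: fix a real p ≥ 1 and let x : ℤ → ℝ have both polyphase components in ℓp(ℤ) with ‖poly₀(x)‖_p ≠ ‖poly₁(x)‖_p. Then for every integer k there exists an integer m such that D^A₂(T_k x) = T_m(D^A₂ x). -/
noncomputable section

/-- Shift operator: `(T k x) n = x (n - k)`. -/
def T (k : ℤ) (x : ℤ → ℝ) : ℤ → ℝ := fun n => x (n - k)

/-- Stride-2 downsampling. -/
def D2 (x : ℤ → ℝ) : ℤ → ℝ := fun n => x (2 * n)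

/-- Stride-2 upsampling. -/
def U2 (y : ℤ → ℝ) : ℤ → ℝ := fun n => if (2 : ℤ) ∣ n then y (n / 2) else 0

/-- Even polyphase component. -/
def poly0 (x : ℤ → ℝ) : ℤ → ℝ := fun n => x (2 * n)

/-- Odd polyphase component. -/
def poly1 (x : ℤ → ℝ) : ℤ → ℝ := fun n => x (2 * n + 1)

/-- Membership in ℓp(ℤ): summability of |f|^p. -/
def Memlp (p : ℝ) (f : ℤ → ℝ) : Prop := Summable (fun n => |f n| ^ p)

/-- The ℓp norm of a signal. -/
def lpNorm (p : ℝ) (f : ℤ → ℝ) : ℝ := (∑' n, |f n| ^ p) ^ (1 / p)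

/-- APS index: the index of the polyphase component with larger ℓp norm. -/
def apsIndex (p : ℝ) (x : ℤ → ℝ) : ℤ :=
  if lpNorm p (poly0 x) < lpNorm p (poly1 x) then 1 else 0

/-- Adaptive polyphase downsampling: the polyphase component with larger ℓp norm. -/
def apsD (p : ℝ) (x : ℤ → ℝ) : ℤ → ℝ :=
  if lpNorm p (poly0 x) < lpNorm p (poly1 x) then poly1 x else poly0 x

/-- Adaptive polyphase upsampling with grid index `i`. -/
def apsU (i : ℤ) (y : ℤ → ℝ) : ℤ → ℝ := T i (U2 y)

theorem lpNorm_T (p : ℝ) (k : ℤ) (f : ℤ → ℝ) : lpNorm p (T k f) = lpNorm p f := by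
  unfold lpNorm T
  rw [(Equiv.subRight k).tsum_eq (fun n => |f n| ^ p) |>.symm]
  rfl

theorem poly0_T_even (j : ℤ) (x : ℤ → ℝ) : poly0 (T (2 * j) x) = T j (poly0 x) := by
  funext n
  exact congrArg x (by ring)

theorem poly1_T_even (j : ℤ) (x : ℤ → ℝ) : poly1 (T (2 * j) x) = T j (poly1 x) := by
  funext n
  exact congrArg x (by ring)

theorem poly0_T_odd (j : ℤ) (x : ℤ → ℝ) :
    poly0 (T (2 * j + 1) x) = T (j + 1) (poly1 x) := by
  funext n
  exact congrArg x (by ring)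

theorem poly1_T_odd (j : ℤ) (x : ℤ → ℝ) : poly1 (T (2 * j + 1) x) = T j (poly0 x) := by
  funext n
  exact congrArg x (by ring)

theorem apsD_sigma_equivariant (p : ℝ) (hp : 1 ≤ p) (x : ℤ → ℝ)
    (h0 : Memlp p (poly0 x)) (h1 : Memlp p (poly1 x))
    (hne : lpNorm p (poly0 x) ≠ lpNorm p (poly1 x)) :
    ∀ k : ℤ, ∃ m : ℤ, apsD p (T k x) = T m (apsD p x) := by
  intro k
  obtain ⟨j, rfl | rfl⟩ := Int.even_or_odd' k
  · refine ⟨j, ?_⟩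
    unfold apsD
    rw [poly0_T_even, poly1_T_even, lpNorm_T, lpNorm_T]
    split_ifs <;> rfl
  · unfold apsD
    rw [poly0_T_odd, poly1_T_odd, lpNorm_T, lpNorm_T]
    rcases lt_or_gt_of_ne hne with h | h
    · exact ⟨j + 1, by rw [if_neg h.not_gt, if_pos h]⟩
    · exact ⟨j, by rw [if_pos h, if_neg h.not_gt]⟩
end
end

section
/- Proposition 1 (shift equivariance of APS up-down composition): fix a real p ≥ 1 and let x : ℤ → ℝ have both polyphase components in ℓp(ℤ) with ‖poly₀(x)‖_p ≠ ‖poly₁(x)‖_p. Then for every integer k, U^A₂(D^A₂(T_k x), i_{T_k x}) = T_k(U^A₂(D^A₂ x, i_x)). -/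
noncomputable section

theorem poly0_T_two_mul (m : ℤ) (x : ℤ → ℝ) : poly0 (T (2 * m) x) = T m (poly0 x) := by
  funext n
  simp only [poly0, T]
  congr 1
  ring

theorem poly1_T_two_mul (m : ℤ) (x : ℤ → ℝ) : poly1 (T (2 * m) x) = T m (poly1 x) := by
  funext n
  simp only [poly1, T]
  congr 1
  ring

theorem poly0_T_two_mul_add_one (m : ℤ) (x : ℤ → ℝ) :
    poly0 (T (2 * m + 1) x) = T (m + 1) (poly1 x) := by
  funext n
  simp only [poly0, poly1, T]
  congr 1
  ring

theorem poly1_T_two_mul_add_one (m : ℤ) (x : ℤ → ℝ) :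
    poly1 (T (2 * m + 1) x) = T m (poly0 x) := by
  funext n
  simp only [poly0, poly1, T]
  congr 1
  ring

/-- A shift by `k` moves the APS index by `k` modulo 2. -/
theorem two_dvd_apsIndex_T_sub (p : ℝ) (x : ℤ → ℝ)
    (hne : lpNorm p (poly0 x) ≠ lpNorm p (poly1 x)) (k : ℤ) :
    (2 : ℤ) ∣ apsIndex p (T k x) - k - apsIndex p x := by
  obtain ⟨m, rfl | rfl⟩ := Int.even_or_odd' k
  · simp only [apsIndex, poly0_T_two_mul, poly1_T_two_mul, lpNorm_T]
    omega
  · simp only [apsIndex, poly0_T_two_mul_add_one, poly1_T_two_mul_add_one, lpNorm_T]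
    rcases hne.lt_or_gt with h | h
    · rw [if_neg h.not_gt, if_pos h]
      omega
    · rw [if_pos h, if_neg h.not_gt]
      omega

/-- Down-up sampling keeps the samples on the selected grid and zeroes the others. -/
theorem apsU_apsD_apply (p : ℝ) (x : ℤ → ℝ) (n : ℤ) :
    apsU (apsIndex p x) (apsD p x) n = if (2 : ℤ) ∣ n - apsIndex p x then x n else 0 := by
  simp only [apsU, T, U2]
  split_ifs with hd
  · unfold apsD
    unfold apsIndex at hd ⊢
    split_ifs at hd ⊢
    · simp only [poly1]
      congr 1
      omega
    · simp only [poly0]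
      congr 1
      omega
  · rfl

theorem apsU_apsD_shift_equivariant (p : ℝ) (hp : 1 ≤ p) (x : ℤ → ℝ)
    (h0 : Memlp p (poly0 x)) (h1 : Memlp p (poly1 x))
    (hne : lpNorm p (poly0 x) ≠ lpNorm p (poly1 x)) :
    ∀ k : ℤ,
      apsU (apsIndex p (T k x)) (apsD p (T k x)) =
        T k (apsU (apsIndex p x) (apsD p x)) := by
  intro k
  funext n
  have hk := two_dvd_apsIndex_T_sub p x hne k
  rw [apsU_apsD_apply, T, T, apsU_apsD_apply]
  exact if_congr (by omega) rfl rfl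
end
end

section
/- Two signals whose APS indices differ can have identical APS-downsampled outputs even though the signals are not equal: there exist signals x, x̃ : ℤ → ℝ with finitely many nonzero entries such that x̃ = T₁ x, both have distinct polyphase ℓp norms (for p = 2), D^A₂ x = D^A₂ x̃, and x ≠ x̃; hence the map x ↦ D^A₂ x is not injective on shifts and the relative shift between x and x̃ is lost after APS downsampling. -/
noncomputable section

theorem lpNorm_two_zero : lpNorm 2 0 = 0 := by
  simp [lpNorm]

theorem lpNorm_two_single : lpNorm 2 (Pi.single 0 1) = 1 := by
  have h : ∑' n : ℤ, |(Pi.single 0 1 : ℤ → ℝ) n| ^ (2 : ℝ) = 1 := by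
    rw [tsum_eq_single 0 fun n hn => by simp [hn]]
    simp
  rw [lpNorm, h, Real.one_rpow]

theorem poly0_single : poly0 (Pi.single 0 1) = Pi.single 0 1 := by
  funext n
  simp [poly0, Pi.single_apply]

theorem poly1_single : poly1 (Pi.single 0 1) = 0 := by
  funext n
  have h : 2 * n + 1 ≠ 0 := by omega
  simp [poly1, h]

theorem poly0_T_one_single : poly0 (T 1 (Pi.single 0 1)) = 0 := by
  funext n
  have h : 2 * n - 1 ≠ 0 := by omega
  simp [poly0, T, h]

theorem poly1_T_one (x : ℤ → ℝ) : poly1 (T 1 x) = poly0 x := by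
  funext n
  simp [poly0, poly1, T]

theorem apsD_loses_relative_shift :
    ∃ x xt : ℤ → ℝ,
      {n : ℤ | x n ≠ 0}.Finite ∧ {n : ℤ | xt n ≠ 0}.Finite ∧
      xt = T 1 x ∧
      lpNorm 2 (poly0 x) ≠ lpNorm 2 (poly1 x) ∧
      lpNorm 2 (poly0 xt) ≠ lpNorm 2 (poly1 xt) ∧
      apsD 2 x = apsD 2 xt ∧
      x ≠ xt := by
  refine ⟨Pi.single 0 1, T 1 (Pi.single 0 1), ?_, ?_, rfl, ?_, ?_, ?_, ?_⟩
  · refine (Set.finite_singleton 0).subset fun n hn => ?_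
    by_contra h
    exact hn (Pi.single_eq_of_ne h 1)
  · refine (Set.finite_singleton 1).subset fun n hn => ?_
    by_contra h
    exact hn (Pi.single_eq_of_ne (sub_ne_zero.mpr h) 1)
  · simp [poly0_single, poly1_single, lpNorm_two_zero, lpNorm_two_single]
  · simp [poly0_T_one_single, poly1_T_one, poly0_single, lpNorm_two_zero, lpNorm_two_single]
  · simp [apsD, poly0_T_one_single, poly1_T_one, poly0_single, poly1_single,
      lpNorm_two_zero, lpNorm_two_single, zero_le_one.not_gt]
  · intro h
    have h0 := congrFun h 0
    simp [T] at h0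
end
end
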